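/- Let x₁,…,xₙ be a time-homogeneous Markov chain on a k-sparse space X ⊆ ℝ^D with stationary distribution ρ, uniformly quickly forgetting its past, let Φ ∈ ℝ^{D×d} be fixed, let X denote the n×D matrix of states, m_max = max_{z∈X}‖zᵀΦ‖, and Σ_Φ = E_{x∼ρ}[(Φᵀx)(Φᵀx)ᵀ]. Then there exist constants c₃, c₄ > 0 depending only on the transition kernel such that for any 0 < ξ₄ < 1, with probability at least 1 − ξ₄, there exists a matrix Y ∈ ℝ^{d×d} with all entries in [−1, 1] (hence ‖Y‖ ≤ d) such that (1/n)·(XΦ)ᵀ(XΦ) = Σ_Φ + ε₀·Y, where ε₀ = m_max²·√((c₃/n)·log(c₄ d²/ξ₄)). -/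

import Mathlib

open MeasureTheory ProbabilityTheory Matrix

noncomputable section

/-- Euclidean (`L²`) norm of a finite-dimensional real vector. -/
def e2norm {m : Type*} [Fintype m] (v : m → ℝ) : ℝ := Real.sqrt (∑ i, v i ^ 2)

/-- Operator norm of a real matrix (w.r.t. Euclidean norms). -/
def opNorm {m n : Type*} [Fintype m] [Fintype n] (M : Matrix m n ℝ) : ℝ :=
  sSup {r | ∃ v : n → ℝ, e2norm v ≤ 1 ∧ r = e2norm (M.mulVec v)}

/-- The `k`-sparse feature space determined by the orthonormal basis `Ψ`. -/
def kSparse (D k : ℕ) (Ψ : Matrix (Fin D) (Fin D) ℝ) : Set (Fin D → ℝ) :=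
  {x | ∃ z : Fin D → ℝ, x = Ψ.mulVec z ∧ Set.ncard {i | z i ≠ 0} ≤ k ∧ e2norm z ≤ 1}

/-- Total variation distance between two measures: `sup_A |μ(A) - ν(A)|`. -/
def tvDist {S : Type*} [MeasurableSpace S] (μ ν : Measure S) : ℝ :=
  sSup {r | ∃ A : Set S, MeasurableSet A ∧ r = |(μ A).toReal - (ν A).toReal|}

/-- The `i`-step transition kernel `T^i`. -/
def kernelIter {S : Type*} [MeasurableSpace S] (T : ProbabilityTheory.Kernel S S) :
    ℕ → ProbabilityTheory.Kernel S S
  | 0 => ProbabilityTheory.Kernel.id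
  | (i + 1) => T ∘ₖ kernelIter T i

/-- The dependence matrix `Γₙ` of a Markov transition kernel. -/
def depMatrix {S : Type*} [MeasurableSpace S] (T : ProbabilityTheory.Kernel S S) (n : ℕ) :
    Matrix (Fin n) (Fin n) ℝ :=
  Matrix.of fun i j =>
    if i = j then 1
    else if i < j then
      Real.sqrt (sSup {r | ∃ p : S × S,
        r = tvDist (kernelIter T ((j : ℕ) - (i : ℕ)) p.1) (kernelIter T ((j : ℕ) - (i : ℕ)) p.2)})
    else 0

/-- A time-homogeneous Markov chain uniformly quickly forgets its past if
`τ = sup_n ‖Γₙ‖² < ∞`. -/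
def UniformlyQuicklyForgets {S : Type*} [MeasurableSpace S]
    (T : ProbabilityTheory.Kernel S S) : Prop :=
  ∃ τ : ℝ, ∀ n : ℕ, opNorm (depMatrix T n) ^ 2 ≤ τ

/-- σ-algebra generated by `x 0, …, x t`. -/
def pastFiltration {Ω S : Type*} [MeasurableSpace S] (x : ℕ → Ω → S) (t : ℕ) :
    MeasurableSpace Ω :=
  MeasurableSpace.comap (fun ω => fun i : Fin (t + 1) => x i ω) inferInstance

/-- `x 0, …, x (n-1)` is a time-homogeneous Markov chain with transition kernel `T`. -/
def IsMarkovChain {Ω S : Type*} [MeasurableSpace Ω] [MeasurableSpace S]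
    (P : Measure Ω) (T : ProbabilityTheory.Kernel S S) (x : ℕ → Ω → S) (n : ℕ) : Prop :=
  (∀ t, t < n → Measurable (x t)) ∧
  ∀ t, t + 1 < n → ∀ A : Set S, MeasurableSet A →
    (P[fun ω => A.indicator (fun _ => (1 : ℝ)) (x (t + 1) ω) | pastFiltration x t])
      =ᵐ[P] fun ω => (T (x t ω) A).toReal

section

variable {S : Type*} [MeasurableSpace S]

theorem one_mem_upperBounds_tvDist_set (μ ν : Measure S) [IsProbabilityMeasure μ]
    [IsProbabilityMeasure ν] :
    (1 : ℝ) ∈ upperBounds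
      {r | ∃ A : Set S, MeasurableSet A ∧ r = |(μ A).toReal - (ν A).toReal|} := by
  rintro r ⟨A, -, rfl⟩
  have h1 : (μ A).toReal ≤ 1 := measureReal_le_one
  have h2 : (ν A).toReal ≤ 1 := measureReal_le_one
  have h3 : 0 ≤ (μ A).toReal := ENNReal.toReal_nonneg
  have h4 : 0 ≤ (ν A).toReal := ENNReal.toReal_nonneg
  rw [abs_le]
  constructor <;> linarith

theorem tvDist_nonneg (μ ν : Measure S) : 0 ≤ tvDist μ ν := by
  refine Real.sSup_nonneg ?_
  rintro r ⟨A, -, rfl⟩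
  positivity

theorem tvDist_le_one (μ ν : Measure S) [IsProbabilityMeasure μ] [IsProbabilityMeasure ν] :
    tvDist μ ν ≤ 1 :=
  csSup_le ⟨_, ∅, MeasurableSet.empty, rfl⟩ (one_mem_upperBounds_tvDist_set μ ν)

theorem integrable_of_abs_le {μ : Measure S} [IsFiniteMeasure μ] {f : S → ℝ} {C : ℝ}
    (hf : Measurable f) (hC : ∀ x, |f x| ≤ C) : Integrable f μ :=
  Integrable.of_bound hf.aestronglyMeasurable C (ae_of_all _ hC)

theorem abs_integral_le_of_abs_le {μ : Measure S} [IsProbabilityMeasure μ] {f : S → ℝ} {C : ℝ}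
    (hC : ∀ x, |f x| ≤ C) : |∫ x, f x ∂μ| ≤ C := by
  simpa using norm_integral_le_of_norm_le_const (μ := μ) (f := f) (ae_of_all _ hC)

theorem integral_sub_integral_le_tvDist (μ ν : Measure S) [IsProbabilityMeasure μ]
    [IsProbabilityMeasure ν] {f : S → ℝ} (hf : Measurable f) (h0 : ∀ x, 0 ≤ f x)
    (h1 : ∀ x, f x ≤ 1) : ∫ x, f x ∂μ - ∫ x, f x ∂ν ≤ tvDist μ ν := by
  obtain ⟨s, hs, h_le, h_ge⟩ := exists_isHahnDecomposition μ ν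
  have hb : ∀ x, |f x| ≤ 1 := fun x => abs_le.2 ⟨by linarith [h0 x], h1 x⟩
  have hiμ : Integrable f μ := integrable_of_abs_le hf hb
  have hiν : Integrable f ν := integrable_of_abs_le hf hb
  have hs_le : ∫ x in s, f x ∂μ ≤ ∫ x in s, f x ∂ν :=
    integral_mono_measure h_le (ae_of_all _ h0) hiν.integrableOn
  have hsc_le : ∫ x in sᶜ, (1 - f x) ∂ν ≤ ∫ x in sᶜ, (1 - f x) ∂μ :=
    integral_mono_measure h_ge (ae_of_all _ fun x => sub_nonneg.2 (h1 x))
      ((integrable_const _).sub hiμ).integrableOn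
  rw [integral_sub (integrable_const _) hiμ.integrableOn,
    integral_sub (integrable_const _) hiν.integrableOn] at hsc_le
  simp only [integral_const, smul_eq_mul, mul_one, measureReal_restrict_apply_univ] at hsc_le
  rw [← integral_add_compl hs hiμ, ← integral_add_compl hs hiν]
  have h_sup : |(μ sᶜ).toReal - (ν sᶜ).toReal| ≤ tvDist μ ν :=
    le_csSup ⟨1, one_mem_upperBounds_tvDist_set μ ν⟩ ⟨sᶜ, hs.compl, rfl⟩
  have := le_abs_self ((μ sᶜ).toReal - (ν sᶜ).toReal)
  simp only [Measure.real] at hsc_le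
  linarith

theorem integral_sub_integral_le_two_mul_tvDist (μ ν : Measure S) [IsProbabilityMeasure μ]
    [IsProbabilityMeasure ν] {f : S → ℝ} (hf : Measurable f) (hb : ∀ x, |f x| ≤ 1) :
    ∫ x, f x ∂μ - ∫ x, f x ∂ν ≤ 2 * tvDist μ ν := by
  have h := integral_sub_integral_le_tvDist μ ν (f := fun x => (f x + 1) / 2) (by fun_prop)
    (fun x => by linarith [(abs_le.1 (hb x)).1]) (fun x => by linarith [(abs_le.1 (hb x)).2])
  rw [integral_div, integral_div, integral_add (integrable_of_abs_le hf hb) (integrable_const _),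
    integral_add (integrable_of_abs_le hf hb) (integrable_const _)] at h
  simp only [integral_const, smul_eq_mul, mul_one, probReal_univ] at h
  linarith

/-- The largest total variation distance between two `m`-step transition laws. -/
def mixingCoeff (T : ProbabilityTheory.Kernel S S) (m : ℕ) : ℝ :=
  sSup {r | ∃ p : S × S, r = tvDist (kernelIter T m p.1) (kernelIter T m p.2)}

instance isMarkovKernel_kernelIter (T : ProbabilityTheory.Kernel S S) [IsMarkovKernel T] (m : ℕ) :
    IsMarkovKernel (kernelIter T m) := by
  induction m with
  | zero => unfold kernelIter; infer_instance
  | succ m ih => unfold kernelIter; infer_instance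

theorem kernelIter_succ' (T : ProbabilityTheory.Kernel S S) (m : ℕ) :
    kernelIter T (m + 1) = kernelIter T m ∘ₖ T := by
  induction m with
  | zero => simp [kernelIter]
  | succ m ih =>
    conv_lhs => rw [kernelIter, ih]
    rw [← ProbabilityTheory.Kernel.comp_assoc, kernelIter]

theorem mixingCoeff_nonneg (T : ProbabilityTheory.Kernel S S) (m : ℕ) : 0 ≤ mixingCoeff T m := by
  refine Real.sSup_nonneg ?_
  rintro r ⟨p, rfl⟩
  exact tvDist_nonneg _ _

theorem tvDist_le_mixingCoeff (T : ProbabilityTheory.Kernel S S) [IsMarkovKernel T] (m : ℕ)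
    (x y : S) : tvDist (kernelIter T m x) (kernelIter T m y) ≤ mixingCoeff T m := by
  refine le_csSup ⟨1, ?_⟩ ⟨(x, y), rfl⟩
  rintro r ⟨p, rfl⟩
  exact tvDist_le_one _ _

theorem measurable_integral_kernel (T : ProbabilityTheory.Kernel S S) [IsMarkovKernel T]
    {f : S → ℝ} (hf : Measurable f) : Measurable fun x => ∫ y, f y ∂T x :=
  (hf.stronglyMeasurable.integral_kernel).measurable

theorem integral_kernelIter_succ (T : ProbabilityTheory.Kernel S S) [IsMarkovKernel T] (m : ℕ)
    {f : S → ℝ} {C : ℝ} (hf : Measurable f) (hC : ∀ x, |f x| ≤ C) (x : S) :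
    ∫ y, f y ∂kernelIter T (m + 1) x = ∫ y, ∫ z, f z ∂T y ∂kernelIter T m x :=
  ProbabilityTheory.Kernel.integral_comp (integrable_of_abs_le hf hC)

theorem integral_kernelIter_succ' (T : ProbabilityTheory.Kernel S S) [IsMarkovKernel T] (m : ℕ)
    {f : S → ℝ} {C : ℝ} (hf : Measurable f) (hC : ∀ x, |f x| ≤ C) (x : S) :
    ∫ y, f y ∂kernelIter T (m + 1) x = ∫ y, ∫ z, f z ∂kernelIter T m y ∂T x := by
  rw [kernelIter_succ']
  exact ProbabilityTheory.Kernel.integral_comp (integrable_of_abs_le hf hC)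

theorem integral_integral_of_bind_eq (T : ProbabilityTheory.Kernel S S) [IsMarkovKernel T]
    {ρ : Measure S} [IsProbabilityMeasure ρ] (hρ : ρ.bind (fun s => T s) = ρ)
    {f : S → ℝ} {C : ℝ} (hf : Measurable f) (hC : ∀ x, |f x| ≤ C) :
    ∫ x, ∫ y, f y ∂T x ∂ρ = ∫ x, f x ∂ρ := by
  have hcomp : (T ∘ₖ ProbabilityTheory.Kernel.const Unit ρ) () = ρ := by
    rw [ProbabilityTheory.Kernel.comp_apply, ProbabilityTheory.Kernel.const_apply]
    exact hρ
  have h := ProbabilityTheory.Kernel.integral_comp (η := T)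
    (κ := ProbabilityTheory.Kernel.const Unit ρ) (a := ()) (f := f)
    (by rw [hcomp]; exact integrable_of_abs_le hf hC)
  rw [hcomp, ProbabilityTheory.Kernel.const_apply] at h
  exact h.symm

theorem integral_integral_kernelIter_of_bind_eq (T : ProbabilityTheory.Kernel S S)
    [IsMarkovKernel T] {ρ : Measure S} [IsProbabilityMeasure ρ]
    (hρ : ρ.bind (fun s => T s) = ρ) (m : ℕ) {f : S → ℝ} {C : ℝ} (hf : Measurable f)
    (hC : ∀ x, |f x| ≤ C) : ∫ x, ∫ y, f y ∂kernelIter T m x ∂ρ = ∫ x, f x ∂ρ := by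
  induction m generalizing f with
  | zero =>
    refine integral_congr_ae (ae_of_all _ fun x => ?_)
    simp only [kernelIter, ProbabilityTheory.Kernel.id_apply]
    exact integral_dirac' f x hf.stronglyMeasurable
  | succ m ih =>
    simp only [integral_kernelIter_succ T m hf hC]
    rw [ih (measurable_integral_kernel T hf) fun x => abs_integral_le_of_abs_le hC,
      integral_integral_of_bind_eq T hρ hf hC]

theorem abs_integral_kernelIter_sub_le (T : ProbabilityTheory.Kernel S S) [IsMarkovKernel T]
    {ρ : Measure S} [IsProbabilityMeasure ρ] (hρ : ρ.bind (fun s => T s) = ρ) (m : ℕ)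
    {f : S → ℝ} (hf : Measurable f) (hb : ∀ x, |f x| ≤ 1) (x : S) :
    |∫ y, f y ∂kernelIter T m x - ∫ y, f y ∂ρ| ≤ 2 * mixingCoeff T m := by
  have hbm : ∀ z, |∫ y, f y ∂kernelIter T m z| ≤ 1 := fun z => abs_integral_le_of_abs_le hb
  have hmeas := measurable_integral_kernel (kernelIter T m) hf
  rw [← integral_integral_kernelIter_of_bind_eq T hρ m hf hb]
  have key : ∫ y, f y ∂kernelIter T m x - ∫ z, ∫ y, f y ∂kernelIter T m z ∂ρ =
      ∫ z, (∫ y, f y ∂kernelIter T m x - ∫ y, f y ∂kernelIter T m z) ∂ρ := by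
    rw [integral_sub (integrable_const _) (integrable_of_abs_le hmeas hbm)]
    simp
  rw [key]
  refine abs_integral_le_of_abs_le fun z => abs_le.2 ?_
  have h1 := integral_sub_integral_le_two_mul_tvDist (kernelIter T m x) (kernelIter T m z) hf hb
  have h2 := integral_sub_integral_le_two_mul_tvDist (kernelIter T m z) (kernelIter T m x) hf hb
  have h3 := tvDist_le_mixingCoeff T m x z
  have h4 := tvDist_le_mixingCoeff T m z x
  constructor <;> linarith

end

theorem abs_apply_le_e2norm {m : Type*} [Fintype m] (v : m → ℝ) (i : m) : |v i| ≤ e2norm v := by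
  rw [← Real.sqrt_sq_eq_abs]
  exact Real.sqrt_le_sqrt
    (Finset.single_le_sum (f := fun i => v i ^ 2) (fun j _ => sq_nonneg _) (Finset.mem_univ i))

theorem bddAbove_image_e2norm_le_one {m : Type*} [Fintype m] {F : (m → ℝ) → ℝ}
    (hF : Continuous F) : BddAbove {r | ∃ v : m → ℝ, e2norm v ≤ 1 ∧ r = F v} := by
  have hK : IsCompact (Set.Icc (fun _ : m => (-1 : ℝ)) fun _ => 1) := isCompact_Icc
  refine (hK.bddAbove_image hF.continuousOn).mono ?_
  rintro r ⟨v, hv, rfl⟩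
  have hi : ∀ i, |v i| ≤ 1 := fun i => (abs_apply_le_e2norm v i).trans hv
  exact ⟨v, ⟨fun i => (abs_le.1 (hi i)).1, fun i => (abs_le.1 (hi i)).2⟩, rfl⟩

theorem continuous_e2norm {m : Type*} [Fintype m] : Continuous (e2norm (m := m)) := by
  unfold e2norm
  fun_prop

theorem sum_col_sq_le_opNorm_sq {m n : Type*} [Fintype m] [Fintype n] [DecidableEq n]
    (M : Matrix m n ℝ) (j : n) : ∑ i, M i j ^ 2 ≤ opNorm M ^ 2 := by
  have hb : BddAbove {r | ∃ v : n → ℝ, e2norm v ≤ 1 ∧ r = e2norm (M.mulVec v)} :=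
    bddAbove_image_e2norm_le_one
      (continuous_e2norm.comp (Continuous.matrix_mulVec continuous_const continuous_id))
  have h1 : e2norm (Pi.single j (1 : ℝ)) ≤ 1 := by
    simp [e2norm, Pi.single_apply]
  have h2 : e2norm (M.mulVec (Pi.single j 1)) ≤ opNorm M := le_csSup hb ⟨_, h1, rfl⟩
  have h3 : e2norm (M.mulVec (Pi.single j 1)) ^ 2 = ∑ i, M i j ^ 2 := by
    rw [e2norm, Real.sq_sqrt (Finset.sum_nonneg fun i _ => sq_nonneg _)]
    simp
  rw [← h3]
  exact pow_le_pow_left₀ (Real.sqrt_nonneg _) h2 2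

theorem sum_mixingCoeff_le {S : Type*} [MeasurableSpace S] (T : ProbabilityTheory.Kernel S S)
    {τ : ℝ} (hτ : ∀ n : ℕ, opNorm (depMatrix T n) ^ 2 ≤ τ) (n : ℕ) :
    ∑ m ∈ Finset.range n, mixingCoeff T (m + 1) ≤ τ := by
  refine le_trans ?_ ((sum_col_sq_le_opNorm_sq (depMatrix T (n + 1)) (Fin.last n)).trans
    (hτ (n + 1)))
  rw [Fin.sum_univ_castSucc, ← Finset.sum_range_reflect, Finset.sum_range]
  refine le_add_of_le_of_nonneg (le_of_eq ?_) (sq_nonneg _)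
  refine Finset.sum_congr rfl fun i _ => ?_
  have hlt : i.castSucc < Fin.last n := Fin.castSucc_lt_last i
  have hsub : ((Fin.last n : Fin (n + 1)) : ℕ) - (i.castSucc : ℕ) = n - 1 - i + 1 := by
    have := i.isLt
    simp only [Fin.val_last, Fin.val_castSucc]
    omega
  simp only [depMatrix, Matrix.of_apply, hlt.ne, hlt, if_true, if_false, hsub]
  exact (Real.sq_sqrt (mixingCoeff_nonneg T _)).symm

section

variable {S : Type*} [MeasurableSpace S]

/-- The expected sum of the first `r` values of `f` along the chain started at `x`. -/
def expectedSum (T : ProbabilityTheory.Kernel S S) (f : S → ℝ) (r : ℕ) (x : S) : ℝ :=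
  ∑ m ∈ Finset.range r, ∫ y, f y ∂kernelIter T m x

theorem measurable_expectedSum (T : ProbabilityTheory.Kernel S S) [IsMarkovKernel T]
    {f : S → ℝ} (hf : Measurable f) (r : ℕ) : Measurable (expectedSum T f r) :=
  Finset.measurable_fun_sum _ fun m _ => measurable_integral_kernel (kernelIter T m) hf

theorem expectedSum_succ (T : ProbabilityTheory.Kernel S S) [IsMarkovKernel T]
    {f : S → ℝ} {C : ℝ} (hf : Measurable f) (hC : ∀ x, |f x| ≤ C) (r : ℕ) (x : S) :
    expectedSum T f (r + 1) x = f x + ∫ y, expectedSum T f r y ∂T x := by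
  unfold expectedSum
  rw [Finset.sum_range_succ', add_comm, integral_finsetSum]
  · congr 1
    · simp only [kernelIter, ProbabilityTheory.Kernel.id_apply]
      exact integral_dirac' f x hf.stronglyMeasurable
    · exact Finset.sum_congr rfl fun m _ => integral_kernelIter_succ' T m hf hC x
  · exact fun m _ => integrable_of_abs_le (measurable_integral_kernel (kernelIter T m) hf)
      fun z => abs_integral_le_of_abs_le hC

theorem integral_expectedSum (T : ProbabilityTheory.Kernel S S) [IsMarkovKernel T]
    {ρ : Measure S} [IsProbabilityMeasure ρ] (hρ : ρ.bind (fun s => T s) = ρ)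
    {f : S → ℝ} {C : ℝ} (hf : Measurable f) (hC : ∀ x, |f x| ≤ C) (h0 : ∫ x, f x ∂ρ = 0)
    (r : ℕ) : ∫ x, expectedSum T f r x ∂ρ = 0 := by
  unfold expectedSum
  rw [integral_finsetSum]
  · exact Finset.sum_eq_zero fun m _ => by
      rw [integral_integral_kernelIter_of_bind_eq T hρ m hf hC, h0]
  · exact fun m _ => integrable_of_abs_le (measurable_integral_kernel (kernelIter T m) hf)
      fun z => abs_integral_le_of_abs_le hC

theorem abs_expectedSum_centered_le (T : ProbabilityTheory.Kernel S S) [IsMarkovKernel T]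
    {τ : ℝ} (hτ : ∀ n : ℕ, opNorm (depMatrix T n) ^ 2 ≤ τ)
    {ρ : Measure S} [IsProbabilityMeasure ρ] (hρ : ρ.bind (fun s => T s) = ρ)
    {f : S → ℝ} (hf : Measurable f) (hb : ∀ x, |f x| ≤ 1) (r : ℕ) (x : S) :
    |expectedSum T (fun z => f z - ∫ y, f y ∂ρ) r x| ≤ 2 * (1 + τ) := by
  have hτ0 : 0 ≤ τ := (sq_nonneg _).trans (hτ 0)
  cases r with
  | zero => simpa [expectedSum] using by linarith
  | succ r =>
    have hterm : ∀ m, ∫ z, (f z - ∫ y, f y ∂ρ) ∂kernelIter T m x =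
        ∫ y, f y ∂kernelIter T m x - ∫ y, f y ∂ρ := fun m => by
      rw [integral_sub (integrable_of_abs_le hf hb) (integrable_const _)]
      simp
    unfold expectedSum
    refine (Finset.abs_sum_le_sum_abs _ _).trans ?_
    rw [Finset.sum_range_succ']
    have h1 : |∫ z, (f z - ∫ y, f y ∂ρ) ∂kernelIter T 0 x| ≤ 2 := by
      refine abs_integral_le_of_abs_le fun z => (abs_sub _ _).trans ?_
      linarith [hb z, abs_integral_le_of_abs_le (μ := ρ) hb]
    have h2 : ∑ m ∈ Finset.range r, |∫ z, (f z - ∫ y, f y ∂ρ) ∂kernelIter T (m + 1) x| ≤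
        ∑ m ∈ Finset.range r, 2 * mixingCoeff T (m + 1) :=
      Finset.sum_le_sum fun m _ => by
        rw [hterm]
        exact abs_integral_kernelIter_sub_le T hρ (m + 1) hf hb x
    rw [← Finset.mul_sum] at h2
    linarith [sum_mixingCoeff_le T hτ r]

theorem lintegral_exp_mul_le {μ : Measure S} [IsProbabilityMeasure μ] {g : S → ℝ} {K : ℝ}
    (hg : Measurable g) (hK : ∀ x, |g x| ≤ K) (lam : ℝ) :
    ∫⁻ x, ENNReal.ofReal (Real.exp (lam * g x)) ∂μ ≤
      ENNReal.ofReal (Real.exp (lam * ∫ x, g x ∂μ) * Real.exp (K ^ 2 * lam ^ 2 / 2)) := by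
  have hsub := hasSubgaussianMGF_of_mem_Icc (μ := μ) (X := g) (a := -K) (b := K)
    hg.aemeasurable (ae_of_all _ fun x => abs_le.1 (hK x))
  have hint := hsub.integrable_exp_mul lam
  have hle := hsub.mgf_le lam
  have hc : (((‖K - -K‖₊ / 2) ^ 2 : NNReal) : ℝ) = K ^ 2 := by
    push_cast
    rw [Real.norm_eq_abs, div_pow, sq_abs]
    ring
  rw [hc] at hle
  have hsplit : ∀ x, Real.exp (lam * g x) =
      Real.exp (lam * ∫ x, g x ∂μ) * Real.exp (lam * (g x - ∫ x, g x ∂μ)) := fun x => by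
    rw [← Real.exp_add]
    ring_nf
  simp_rw [hsplit]
  rw [← ofReal_integral_eq_lintegral_ofReal (hint.const_mul _)
    (ae_of_all _ fun x => by positivity), integral_const_mul]
  exact ENNReal.ofReal_le_ofReal (mul_le_mul_of_nonneg_left hle (Real.exp_pos _).le)

theorem IsMarkovChain.measurable_past {Ω : Type*} [MeasurableSpace Ω] {P : Measure Ω}
    {T : ProbabilityTheory.Kernel S S} {x : ℕ → Ω → S} {n : ℕ} (h : IsMarkovChain P T x n) {t : ℕ}
    (ht : t + 1 < n) :
    Measurable fun ω => fun i : Fin (t + 1) => x i ω :=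
  measurable_pi_lambda _ fun i => h.1 i (by omega)

variable {Ω : Type*} [MeasurableSpace Ω] {P : Measure Ω} [IsProbabilityMeasure P]
  {T : ProbabilityTheory.Kernel S S} [IsMarkovKernel T] {x : ℕ → Ω → S} {n : ℕ}

theorem IsMarkovChain.map_past_next (h : IsMarkovChain P T x n) {t : ℕ} (ht : t + 1 < n) :
    P.map (fun ω => ((fun i : Fin (t + 1) => x i ω), x (t + 1) ω)) =
      (P.map fun ω => fun i : Fin (t + 1) => x i ω) ⊗ₘ
        T.comap (fun p : Fin (t + 1) → S => p (Fin.last t)) (measurable_pi_apply _) := by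
  have hpast := h.measurable_past ht
  have hnext := h.1 (t + 1) ht
  have hlast := h.1 t (by omega)
  have : IsProbabilityMeasure (P.map fun ω => fun i : Fin (t + 1) => x i ω) :=
    Measure.isProbabilityMeasure_map hpast.aemeasurable
  have : IsProbabilityMeasure (P.map (fun ω => ((fun i : Fin (t + 1) => x i ω), x (t + 1) ω))) :=
    Measure.isProbabilityMeasure_map (hpast.prodMk hnext).aemeasurable
  refine Measure.ext_prod fun {B A} hB hA => ?_
  have hBpre : MeasurableSet ((fun ω => fun i : Fin (t + 1) => x i ω) ⁻¹' B) := hpast hB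
  have hm : pastFiltration x t ≤ (inferInstance : MeasurableSpace Ω) := hpast.comap_le
  have hind : (fun ω => A.indicator (fun _ => (1 : ℝ)) (x (t + 1) ω)) =
      (x (t + 1) ⁻¹' A).indicator fun _ => (1 : ℝ) := rfl
  have hint : Integrable (fun ω => A.indicator (fun _ => (1 : ℝ)) (x (t + 1) ω)) P := by
    rw [hind]
    exact (integrable_const _).indicator (hnext hA)
  have hset := setIntegral_condExp hm hint (s := (fun ω => fun i : Fin (t + 1) => x i ω) ⁻¹' B)
    ⟨B, hB, rfl⟩
  rw [setIntegral_congr_ae hBpre ((h.2 t ht A hA).mono fun ω hω _ => hω), hind,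
    setIntegral_indicator (hnext hA), setIntegral_const, smul_eq_mul, mul_one,
    integral_toReal (f := fun ω => T (x t ω) A)
      ((ProbabilityTheory.Kernel.measurable_coe T hA).comp hlast).aemeasurable
      (ae_of_all _ fun ω => measure_lt_top (T (x t ω)) A), Measure.real] at hset
  rw [Measure.compProd_apply_prod hB hA, Measure.map_apply (hpast.prodMk hnext) (hB.prod hA),
    setLIntegral_map hB (ProbabilityTheory.Kernel.measurable_coe _ hA) hpast]
  simp only [ProbabilityTheory.Kernel.comap_apply, Fin.val_last]
  refine ((ENNReal.toReal_eq_toReal_iff' ?_ (measure_ne_top _ _)).1 hset).symm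
  refine ne_top_of_le_ne_top (measure_ne_top P Set.univ) ?_
  calc _ ≤ ∫⁻ ω in (fun ω => fun i : Fin (t + 1) => x i ω) ⁻¹' B, 1 ∂P :=
        lintegral_mono fun ω => prob_le_one
    _ ≤ P Set.univ := by
        rw [setLIntegral_one]
        exact measure_mono (Set.subset_univ _)

theorem IsMarkovChain.lintegral_past_next (h : IsMarkovChain P T x n) {t : ℕ} (ht : t + 1 < n)
    {F : (Fin (t + 1) → S) × S → ENNReal} (hF : Measurable F) :
    ∫⁻ ω, F ((fun i : Fin (t + 1) => x i ω), x (t + 1) ω) ∂P =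
      ∫⁻ ω, ∫⁻ y, F ((fun i : Fin (t + 1) => x i ω), y) ∂T (x t ω) ∂P := by
  have hpast := h.measurable_past ht
  have : IsProbabilityMeasure (P.map fun ω => fun i : Fin (t + 1) => x i ω) :=
    Measure.isProbabilityMeasure_map hpast.aemeasurable
  rw [← lintegral_map hF (hpast.prodMk (h.1 _ ht)), h.map_past_next ht,
    Measure.lintegral_compProd hF, lintegral_map (by
      exact hF.lintegral_kernel_prod_right') hpast]
  rfl

theorem IsMarkovChain.lintegral_exp_step (h : IsMarkovChain P T x n) {t : ℕ} (ht : t + 1 < n)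
    {f g : S → ℝ} {K : ℝ} (hf : Measurable f) (hg : Measurable g) (hK : ∀ y, |g y| ≤ K)
    (lam : ℝ) :
    ∫⁻ ω, ENNReal.ofReal
        (Real.exp (lam * (∑ s ∈ Finset.range (t + 1), f (x s ω) + g (x (t + 1) ω)))) ∂P ≤
      ENNReal.ofReal (Real.exp (K ^ 2 * lam ^ 2 / 2)) * ∫⁻ ω, ENNReal.ofReal
        (Real.exp (lam * (∑ s ∈ Finset.range (t + 1), f (x s ω) + ∫ y, g y ∂T (x t ω)))) ∂P := by
  have hF : Measurable fun p : (Fin (t + 1) → S) × S =>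
      ENNReal.ofReal (Real.exp (lam * (∑ s, f (p.1 s) + g p.2))) := by fun_prop
  have hL := h.lintegral_past_next ht hF
  simp only [Finset.sum_range]
  rw [hL, ← lintegral_const_mul' _ _ ENNReal.ofReal_ne_top]
  refine lintegral_mono fun ω => ?_
  simp only [mul_add, Real.exp_add, ENNReal.ofReal_mul (Real.exp_pos _).le]
  rw [lintegral_const_mul' _ _ ENNReal.ofReal_ne_top, mul_left_comm]
  refine mul_le_mul_right ?_ _
  refine (lintegral_exp_mul_le hg hK lam).trans (le_of_eq ?_)
  rw [ENNReal.ofReal_mul (Real.exp_pos _).le, mul_comm]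

theorem IsMarkovChain.lintegral_exp_sum_le (h : IsMarkovChain P T x n) (hn : 0 < n)
    {ρ : Measure S} [IsProbabilityMeasure ρ] (hρ : ρ.bind (fun s => T s) = ρ)
    (hmap : ∀ t, t < n → P.map (x t) = ρ) {f : S → ℝ} {C K : ℝ} (hf : Measurable f)
    (hC : ∀ y, |f y| ≤ C) (h0 : ∫ y, f y ∂ρ = 0) (hK : ∀ r y, |expectedSum T f r y| ≤ K)
    (lam : ℝ) :
    ∫⁻ ω, ENNReal.ofReal (Real.exp (lam * ∑ s ∈ Finset.range n, f (x s ω))) ∂P ≤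
      ENNReal.ofReal (Real.exp (K ^ 2 * lam ^ 2 / 2)) ^ n := by
  have key : ∀ t, t < n → ∫⁻ ω, ENNReal.ofReal (Real.exp (lam *
      (∑ s ∈ Finset.range t, f (x s ω) + expectedSum T f (n - t) (x t ω)))) ∂P ≤
        ENNReal.ofReal (Real.exp (K ^ 2 * lam ^ 2 / 2)) ^ (t + 1) := by
    intro t
    induction t with
    | zero =>
      intro ht
      have hm := measurable_expectedSum T hf n
      have hmap0 := lintegral_map (μ := P) (g := x 0)
        (f := fun y => ENNReal.ofReal (Real.exp (lam * expectedSum T f n y)))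
        (by fun_prop) (h.1 0 ht)
      rw [hmap 0 ht] at hmap0
      simp only [Finset.range_zero, Finset.sum_empty, zero_add, Nat.sub_zero, pow_one]
      rw [← hmap0]
      refine (lintegral_exp_mul_le hm (hK n) lam).trans ?_
      rw [integral_expectedSum T hρ hf hC h0, mul_zero, Real.exp_zero, one_mul]
    | succ t ih =>
      intro ht
      refine (h.lintegral_exp_step ht hf (measurable_expectedSum T hf _) (hK _) lam).trans ?_
      rw [pow_succ' _ (t + 1)]
      refine mul_le_mul_right ((le_of_eq ?_).trans (ih (by omega))) _
      refine lintegral_congr fun ω => ?_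
      rw [Finset.sum_range_succ, show n - t = n - (t + 1) + 1 by omega,
        expectedSum_succ T hf hC, add_assoc]
  obtain ⟨m, rfl⟩ : ∃ m, n = m + 1 := ⟨n - 1, by omega⟩
  refine (le_of_eq ?_).trans (key m (by omega))
  refine lintegral_congr fun ω => ?_
  rw [Finset.sum_range_succ, show m + 1 - m = 0 + 1 by omega, expectedSum_succ T hf hC]
  simp [expectedSum]

theorem IsMarkovChain.measure_sum_ge_le (h : IsMarkovChain P T x n) (hn : 0 < n)
    {ρ : Measure S} [IsProbabilityMeasure ρ] (hρ : ρ.bind (fun s => T s) = ρ)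
    (hmap : ∀ t, t < n → P.map (x t) = ρ) {f : S → ℝ} {C K : ℝ} (hf : Measurable f)
    (hC : ∀ y, |f y| ≤ C) (h0 : ∫ y, f y ∂ρ = 0) (hK : ∀ r y, |expectedSum T f r y| ≤ K)
    (hK0 : 0 < K) {s : ℝ} (hs : 0 ≤ s) :
    P {ω | s ≤ ∑ t ∈ Finset.range n, f (x t ω)} ≤
      ENNReal.ofReal (Real.exp (-(s ^ 2 / (2 * n * K ^ 2)))) := by
  have hn' : (0 : ℝ) < n := by exact_mod_cast hn
  set lam : ℝ := s / (n * K ^ 2) with hlam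
  have hlam0 : 0 ≤ lam := by positivity
  have hmeas : AEMeasurable
      (fun ω => ENNReal.ofReal (Real.exp (lam * ∑ t ∈ Finset.range n, f (x t ω)))) P := by
    have : Measurable fun ω => ∑ t ∈ Finset.range n, f (x t ω) :=
      Finset.measurable_fun_sum _ fun t ht => hf.comp (h.1 t (Finset.mem_range.1 ht))
    exact Measurable.aemeasurable (by fun_prop)
  have hmarkov := mul_meas_ge_le_lintegral₀ hmeas (ENNReal.ofReal (Real.exp (lam * s)))
  have hsub : P {ω | s ≤ ∑ t ∈ Finset.range n, f (x t ω)} ≤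
      P {ω | ENNReal.ofReal (Real.exp (lam * s)) ≤
        ENNReal.ofReal (Real.exp (lam * ∑ t ∈ Finset.range n, f (x t ω)))} :=
    measure_mono fun ω hω => ENNReal.ofReal_le_ofReal
      (Real.exp_le_exp.2 (mul_le_mul_of_nonneg_left hω hlam0))
  have hexp := h.lintegral_exp_sum_le hn hρ hmap hf hC h0 hK lam
  have hfin : ENNReal.ofReal (Real.exp (lam * s)) *
      P {ω | s ≤ ∑ t ∈ Finset.range n, f (x t ω)} ≤
        ENNReal.ofReal (Real.exp (K ^ 2 * lam ^ 2 / 2)) ^ n :=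
    (mul_le_mul_right hsub _).trans (hmarkov.trans hexp)
  rw [← ENNReal.ofReal_pow (Real.exp_pos _).le, ← Real.exp_nat_mul, mul_comm,
    ← ENNReal.le_div_iff_mul_le (Or.inl (by positivity)) (Or.inl ENNReal.ofReal_ne_top),
    ← ENNReal.ofReal_div_of_pos (Real.exp_pos _), ← Real.exp_sub] at hfin
  refine hfin.trans (le_of_eq ?_)
  congr 2
  rw [hlam]
  field_simp
  ring

/-- Hoeffding's inequality for a bounded function of a stationary uniformly mixing chain. -/
theorem IsMarkovChain.measure_abs_sum_sub_ge_le (h : IsMarkovChain P T x n) (hn : 0 < n)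
    {τ : ℝ} (hτ : ∀ n : ℕ, opNorm (depMatrix T n) ^ 2 ≤ τ)
    {ρ : Measure S} [IsProbabilityMeasure ρ] (hρ : ρ.bind (fun s => T s) = ρ)
    (hmap : ∀ t, t < n → P.map (x t) = ρ) {f : S → ℝ} (hf : Measurable f)
    (hb : ∀ y, |f y| ≤ 1) {s : ℝ} (hs : 0 ≤ s) :
    P {ω | s ≤ |∑ t ∈ Finset.range n, f (x t ω) - n * ∫ y, f y ∂ρ|} ≤
      ENNReal.ofReal (2 * Real.exp (-(s ^ 2 / (2 * n * (2 * (1 + τ)) ^ 2)))) := by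
  have hτ0 : 0 ≤ τ := (sq_nonneg _).trans (hτ 0)
  have hK0 : 0 < 2 * (1 + τ) := by positivity
  have one_sided : ∀ {f : S → ℝ}, Measurable f → (∀ y, |f y| ≤ 1) →
      P {ω | s ≤ ∑ t ∈ Finset.range n, (f (x t ω) - ∫ y, f y ∂ρ)} ≤
        ENNReal.ofReal (Real.exp (-(s ^ 2 / (2 * n * (2 * (1 + τ)) ^ 2)))) := by
    intro f hf hb
    refine h.measure_sum_ge_le (f := fun z => f z - ∫ y, f y ∂ρ) (C := 2) hn hρ hmap
      (by fun_prop) (fun z => (abs_sub _ _).trans ?_) ?_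
      (abs_expectedSum_centered_le T hτ hρ hf hb) hK0 hs
    · linarith [hb z, abs_integral_le_of_abs_le (μ := ρ) hb]
    · rw [integral_sub (integrable_of_abs_le hf hb) (integrable_const _)]
      simp
  have hu := one_sided hf hb
  have hl := one_sided (f := fun y => -f y) hf.neg fun y => by rw [abs_neg]; exact hb y
  refine (measure_mono ?_).trans ((measure_union_le _ _).trans ((add_le_add hu hl).trans
    (le_of_eq ?_)))
  · intro ω hω
    rcases le_abs.1 (show s ≤ |_| from hω) with hω | hω
    · left
      simpa [Finset.sum_sub_distrib] using hω
    · right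
      simp only [Set.mem_ofPred_eq, Finset.sum_sub_distrib, integral_neg, Finset.sum_neg_distrib,
        Finset.sum_const, Finset.card_range, nsmul_eq_mul]
      linarith
  · rw [← ENNReal.ofReal_add (Real.exp_pos _).le (Real.exp_pos _).le]
    congr 1
    ring

end

theorem e2norm_vecMul_le_sSup {D k d : ℕ} {Ψ : Matrix (Fin D) (Fin D) ℝ}
    (Φ : Matrix (Fin D) (Fin d) ℝ) {z : Fin D → ℝ} (hz : z ∈ kSparse D k Ψ) :
    e2norm (vecMul z Φ) ≤ sSup {r | ∃ z ∈ kSparse D k Ψ, r = e2norm (vecMul z Φ)} := by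
  refine le_csSup ?_ ⟨z, hz, rfl⟩
  have hcont : Continuous fun w : Fin D → ℝ => e2norm (vecMul (Ψ.mulVec w) Φ) :=
    continuous_e2norm.comp (Continuous.matrix_vecMul
      (Continuous.matrix_mulVec continuous_const continuous_id) continuous_const)
  refine (bddAbove_image_e2norm_le_one hcont).mono ?_
  rintro r ⟨y, ⟨w, rfl, -, hw⟩, rfl⟩
  exact ⟨w, hw, rfl⟩

theorem abs_mul_le_sq_of_e2norm_le {m : Type*} [Fintype m] {v : m → ℝ} {M : ℝ}
    (hv : e2norm v ≤ M) (i j : m) : |v i * v j| ≤ M ^ 2 := by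
  have hi : ∀ i, |v i| ≤ M := fun i => (abs_apply_le_e2norm v i).trans hv
  rw [abs_mul, sq]
  exact mul_le_mul (hi i) (hi j) (abs_nonneg _) ((abs_nonneg _).trans (hi i))

theorem IsMarkovChain.measure_abs_average_sub_gt_le {S Ω : Type*} [MeasurableSpace S]
    [MeasurableSpace Ω] {P : Measure Ω} [IsProbabilityMeasure P]
    {T : ProbabilityTheory.Kernel S S} [IsMarkovKernel T] {x : ℕ → Ω → S} {n : ℕ}
    (h : IsMarkovChain P T x n) (hn : 0 < n)
    {τ : ℝ} (hτ : ∀ n : ℕ, opNorm (depMatrix T n) ^ 2 ≤ τ)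
    {ρ : Measure S} [IsProbabilityMeasure ρ] (hρ : ρ.bind (fun s => T s) = ρ)
    (hmap : ∀ t, t < n → P.map (x t) = ρ) {f : S → ℝ} (hf : Measurable f) {M : ℝ} (hM : 0 ≤ M)
    (hfρ : ∀ᵐ y ∂ρ, |f y| ≤ M) (hfx : ∀ t, t < n → ∀ ω, |f (x t ω)| ≤ M)
    {d ξ : ℝ} (hd : 1 ≤ d) (hξ0 : 0 < ξ) (hξ1 : ξ < 1) :
    P {ω | M * Real.sqrt (2 * (2 * (1 + τ)) ^ 2 / n * Real.log (2 * d ^ 2 / ξ)) <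
        |1 / n * ∑ t ∈ Finset.range n, f (x t ω) - ∫ y, f y ∂ρ|} ≤
      ENNReal.ofReal (ξ / d ^ 2) := by
  have hτ0 : 0 ≤ τ := (sq_nonneg _).trans (hτ 0)
  have hn' : (0 : ℝ) < n := by exact_mod_cast hn
  have hd' : 1 ≤ d ^ 2 := one_le_pow₀ hd
  set g : S → ℝ := fun y => max (-1) (min 1 (f y / M)) with hg
  have hgb : ∀ y, |g y| ≤ 1 := fun y =>
    abs_le.2 ⟨le_max_left _ _, max_le (by norm_num) (min_le_left _ _)⟩
  have hgm : Measurable g := by fun_prop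
  have hfg : ∀ y, |f y| ≤ M → f y = M * g y := by
    intro y hy
    have hdiv : |f y / M| ≤ 1 := by
      rw [abs_div, abs_of_nonneg hM]
      exact div_le_one_of_le₀ hy hM
    rw [hg]
    simp only
    rw [min_eq_right (abs_le.1 hdiv).2, max_eq_right (abs_le.1 hdiv).1,
      mul_div_cancel_of_imp' fun h0 => abs_nonpos_iff.1 (h0 ▸ hy)]
  have hint : ∫ y, f y ∂ρ = M * ∫ y, g y ∂ρ := by
    rw [← integral_const_mul]
    exact integral_congr_ae (hfρ.mono hfg)
  set L : ℝ := Real.log (2 * d ^ 2 / ξ) with hL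
  have harg : 1 ≤ 2 * d ^ 2 / ξ := (one_le_div hξ0).2 (by linarith)
  have hL0 : 0 ≤ L := Real.log_nonneg harg
  set q : ℝ := Real.sqrt (2 * (2 * (1 + τ)) ^ 2 / n * L) with hq
  have hq2 : q ^ 2 = 2 * (2 * (1 + τ)) ^ 2 / n * L := Real.sq_sqrt (by positivity)
  refine (measure_mono (fun ω hω => ?_)).trans ((h.measure_abs_sum_sub_ge_le hn hτ hρ hmap hgm hgb
    (s := n * q) (by positivity)).trans (le_of_eq ?_))
  · have hsum : ∑ t ∈ Finset.range n, f (x t ω) = M * ∑ t ∈ Finset.range n, g (x t ω) := by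
      rw [Finset.mul_sum]
      exact Finset.sum_congr rfl fun t ht => hfg _ (hfx t (Finset.mem_range.1 ht) ω)
    have hω' : M * q < |1 / n * ∑ t ∈ Finset.range n, f (x t ω) - ∫ y, f y ∂ρ| := hω
    have hfactor : 1 / n * ∑ t ∈ Finset.range n, f (x t ω) - ∫ y, f y ∂ρ =
        M * ((∑ t ∈ Finset.range n, g (x t ω) - n * ∫ y, g y ∂ρ) / n) := by
      rw [hsum, hint]
      field_simp
    rw [hfactor, abs_mul, abs_of_nonneg hM, abs_div, abs_of_pos hn'] at hω'
    have hlt := lt_of_mul_lt_mul_left hω' hM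
    rw [lt_div_iff₀ hn'] at hlt
    change n * q ≤ _
    linarith
  · have hexp : (n * q) ^ 2 / (2 * n * (2 * (1 + τ)) ^ 2) = L := by
      rw [mul_pow, hq2]
      field_simp
    rw [hexp, Real.exp_neg, hL, Real.exp_log (by linarith)]
    congr 1
    field_simp

/-- Concentration of the empirical compressed second-moment matrix around `Σ_Φ`: there
exist constants `c₃, c₄ > 0` depending only on the transition kernel such that, with
probability at least `1 - ξ₄`, `(1/n)(XΦ)ᵀ(XΦ) = Σ_Φ + ε₀ Y` for some matrix `Y` with
entries in `[-1,1]` (hence `‖Y‖ ≤ d`), where `ε₀ = m_max²√((c₃/n) log(c₄d²/ξ₄))`. -/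
theorem empirical_covariance_concentration
    (D : ℕ) (T : ProbabilityTheory.Kernel (Fin D → ℝ) (Fin D → ℝ)) [IsMarkovKernel T]
    (hmix : UniformlyQuicklyForgets T) :
    ∃ c₃ c₄ : ℝ, 0 < c₃ ∧ 0 < c₄ ∧
      ∀ (Ω : Type) (_ : MeasurableSpace Ω) (P : Measure Ω), IsProbabilityMeasure P →
      ∀ (k d n : ℕ), 0 < n →
      ∀ (Ψ : Matrix (Fin D) (Fin D) ℝ), Ψᵀ * Ψ = 1 →
      ∀ (ρ : Measure (Fin D → ℝ)), IsProbabilityMeasure ρ →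
        ρ.bind (fun s => T s) = ρ → (∀ᵐ z ∂ρ, z ∈ kSparse D k Ψ) →
      ∀ (x : ℕ → Ω → (Fin D → ℝ)), IsMarkovChain P T x n →
        (∀ t, t < n → Measure.map (x t) P = ρ) →
        (∀ t, t < n → ∀ ω, x t ω ∈ kSparse D k Ψ) →
      ∀ (Φ : Matrix (Fin D) (Fin d) ℝ),
      ∀ (mmax : ℝ), mmax = sSup {r | ∃ z ∈ kSparse D k Ψ, r = e2norm (Matrix.vecMul z Φ)} →
      ∀ (Sφ : Matrix (Fin d) (Fin d) ℝ),
        Sφ = Matrix.of (fun i j => ∫ z, Matrix.vecMul z Φ i * Matrix.vecMul z Φ j ∂ρ) →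
      ∀ (ξ₄ : ℝ), 0 < ξ₄ → ξ₄ < 1 →
        1 - ENNReal.ofReal ξ₄ ≤
          P {ω | ∃ Y : Matrix (Fin d) (Fin d) ℝ, (∀ i j, |Y i j| ≤ 1) ∧
                ((1 : ℝ) / n) • (((Matrix.of fun (t : Fin n) (i : Fin D) => x t ω i) * Φ)ᵀ *
                    ((Matrix.of fun (t : Fin n) (i : Fin D) => x t ω i) * Φ)) =
                  Sφ + (mmax ^ 2 * Real.sqrt (c₃ / n * Real.log (c₄ * d ^ 2 / ξ₄))) • Y} := by
  obtain ⟨τ, hτ⟩ := hmix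
  have hτ0 : 0 ≤ τ := (sq_nonneg _).trans (hτ 0)
  refine ⟨2 * (2 * (1 + τ)) ^ 2, 2, by positivity, two_pos, ?_⟩
  intro Ω _ P _ k d n hn Ψ hΨ ρ _ hρ hρX x hx hmap hxX Φ mmax hmmax Sφ hSφ ξ hξ0 hξ1
  set ε : ℝ := mmax ^ 2 *
    Real.sqrt (2 * (2 * (1 + τ)) ^ 2 / n * Real.log (2 * d ^ 2 / ξ)) with hε
  have hbad : ∀ i j : Fin d, P {ω | ε < |1 / n * ∑ t ∈ Finset.range n,
      vecMul (x t ω) Φ i * vecMul (x t ω) Φ j - Sφ i j|} ≤ ENNReal.ofReal (ξ / d ^ 2) := by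
    intro i j
    have hd : (1 : ℝ) ≤ d := by exact_mod_cast i.pos
    have hM : ∀ z ∈ kSparse D k Ψ, |vecMul z Φ i * vecMul z Φ j| ≤ mmax ^ 2 := fun z hz =>
      abs_mul_le_sq_of_e2norm_le (hmmax ▸ e2norm_vecMul_le_sSup Φ hz) i j
    rw [hSφ, Matrix.of_apply]
    exact hx.measure_abs_average_sub_gt_le hn hτ hρ hmap (by fun_prop) (sq_nonneg _)
      (hρX.mono hM) (fun t ht ω => hM _ (hxX t ht ω)) hd hξ0 hξ1
  set bad : Set Ω := ⋃ i : Fin d, ⋃ j : Fin d, {ω | ε < |1 / n * ∑ t ∈ Finset.range n,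
      vecMul (x t ω) Φ i * vecMul (x t ω) Φ j - Sφ i j|}
  have hPbad : P bad ≤ ENNReal.ofReal ξ := by
    refine (measure_iUnion_fintype_le P _).trans ((Finset.sum_le_sum fun i _ =>
      (measure_iUnion_fintype_le P _).trans (Finset.sum_le_sum fun j _ => hbad i j)).trans ?_)
    rw [Finset.sum_const, Finset.sum_const, Finset.card_univ, Fintype.card_fin, smul_smul,
      nsmul_eq_mul, ← ENNReal.ofReal_natCast, ← ENNReal.ofReal_mul (Nat.cast_nonneg _)]
    refine ENNReal.ofReal_le_ofReal ?_
    rcases Nat.eq_zero_or_pos d with rfl | hd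
    · simpa using hξ0.le
    · have : (d : ℝ) ≠ 0 := by exact_mod_cast hd.ne'
      refine le_of_eq ?_
      push_cast
      field_simp
  rw [tsub_le_iff_right]
  calc (1 : ENNReal) = P Set.univ := measure_univ.symm
    _ ≤ P (badᶜ ∪ bad) := by rw [Set.compl_union_self]
    _ ≤ P badᶜ + P bad := measure_union_le _ _
    _ ≤ _ := add_le_add (measure_mono fun ω hω => ?_) hPbad
  have hgood : ∀ i j : Fin d, |1 / n * ∑ t ∈ Finset.range n,
      vecMul (x t ω) Φ i * vecMul (x t ω) Φ j - Sφ i j| ≤ ε := by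
    intro i j
    by_contra! hlt
    exact hω (Set.mem_iUnion₂.2 ⟨i, j, hlt⟩)
  have hε0 : 0 ≤ ε := by positivity
  refine ⟨Matrix.of fun i j => (1 / n * ∑ t ∈ Finset.range n,
      vecMul (x t ω) Φ i * vecMul (x t ω) Φ j - Sφ i j) / ε, fun i j => ?_, ?_⟩
  · rw [Matrix.of_apply, abs_div, abs_of_nonneg hε0]
    exact div_le_one_of_le₀ (hgood i j) hε0
  · ext i j
    have hentry : (((1 : ℝ) / n) • (((Matrix.of fun (t : Fin n) (i : Fin D) => x t ω i) * Φ)ᵀ *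
        ((Matrix.of fun (t : Fin n) (i : Fin D) => x t ω i) * Φ))) i j =
          1 / n * ∑ t ∈ Finset.range n, vecMul (x t ω) Φ i * vecMul (x t ω) Φ j := by
      rw [Finset.sum_range]
      rfl
    rw [hentry, Matrix.add_apply, Matrix.smul_apply, Matrix.of_apply, smul_eq_mul,
      mul_div_cancel_of_imp' fun h0 => ?_]
    · ring
    · exact abs_nonpos_iff.1 ((hgood i j).trans h0.le)

end
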